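/- arXiv:1603.09575 — 8 statements merged into one kernel-verified Lean document; each statement's English description precedes it below -/
import Mathlib

section
/- Let p₁,…,p_n be distinct points of the upper half-space, pᵢ = (xᵢ,yᵢ,zᵢ) with zᵢ > 0. For p = (x,y,z) with z > 0 set cᵢ(p) = 1 + ((x−xᵢ)² + (y−yᵢ)² + (z−zᵢ)²)/(2 z zᵢ) (the hyperbolic cosine of the hyperbolic distance from p to pᵢ), and define Λ(p) = Σ_{i=1}^n (cᵢ(p)² − 1)^{−1/2} (that is, Λ = Σᵢ 1/sinh d(p,pᵢ)). Then Λ is smooth and satisfies the hyperbolic Helmholtz equation L Λ + Λ = 0 on the upper half-space minus {p₁,…,p_n}. -/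
noncomputable section

/-- Partial derivative in the first upper-half-space coordinate. -/
def pd1 (f : ℝ → ℝ → ℝ → ℝ) (x y z : ℝ) : ℝ := deriv (fun t => f t y z) x

/-- Partial derivative in the second upper-half-space coordinate. -/
def pd2 (f : ℝ → ℝ → ℝ → ℝ) (x y z : ℝ) : ℝ := deriv (fun t => f x t z) y

/-- Partial derivative in the third upper-half-space coordinate. -/
def pd3 (f : ℝ → ℝ → ℝ → ℝ) (x y z : ℝ) : ℝ := deriv (fun t => f x y t) z

/-- Hyperbolic Laplacian in upper half-space coordinates:
`L f = z²(∂²ₓf + ∂²_yf + ∂²_zf) − z ∂_zf`. -/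
def hypLap (f : ℝ → ℝ → ℝ → ℝ) (x y z : ℝ) : ℝ :=
  z ^ 2 * (pd1 (pd1 f) x y z + pd2 (pd2 f) x y z + pd3 (pd3 f) x y z) - z * pd3 f x y z

open Filter Topology

theorem HasDerivAt.inv_sqrt_sq_sub_one {c : ℝ → ℝ} {c' x : ℝ} (hc : HasDerivAt c c' x)
    (h : 0 < c x ^ 2 - 1) :
    HasDerivAt (fun t => 1 / √(c t ^ 2 - 1)) (-(c x * c') * (1 / √(c x ^ 2 - 1)) ^ 3) x := by
  have hs : √(c x ^ 2 - 1) ≠ 0 := (Real.sqrt_pos.2 h).ne'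
  have hd := (((hc.fun_pow 2).sub_const 1).sqrt h.ne').fun_inv hs
  simp only [one_div]
  refine hd.congr_deriv ?_
  field_simp
  norm_num
  ring

theorem hasDerivAt_sum_inv_sqrt_sq_sub_one {ι : Type*} [Fintype ι] {c : ι → ℝ → ℝ}
    {c' : ι → ℝ} {x : ℝ} (hc : ∀ i, HasDerivAt (c i) (c' i) x)
    (h : ∀ i, 0 < c i x ^ 2 - 1) :
    HasDerivAt (fun t => ∑ i, 1 / √(c i t ^ 2 - 1))
      (∑ i, -(c i x * c' i) * (1 / √(c i x ^ 2 - 1)) ^ 3) x :=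
  HasDerivAt.fun_sum fun i _ => (hc i).inv_sqrt_sq_sub_one (h i)

theorem deriv_deriv_sum_inv_sqrt_sq_sub_one {ι : Type*} [Fintype ι] {c c' : ι → ℝ → ℝ}
    {c'' : ι → ℝ} {x : ℝ} (hc : ∀ᶠ t in 𝓝 x, ∀ i, HasDerivAt (c i) (c' i t) t)
    (hc' : ∀ i, HasDerivAt (c' i) (c'' i) x) (h : ∀ i, 0 < c i x ^ 2 - 1) :
    deriv (fun t => deriv (fun s => ∑ i, 1 / √(c i s ^ 2 - 1)) t) x =
      ∑ i, (-(c' i x ^ 2 + c i x * c'' i) * (1 / √(c i x ^ 2 - 1)) ^ 3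
        + 3 * c i x ^ 2 * c' i x ^ 2 * (1 / √(c i x ^ 2 - 1)) ^ 5) := by
  have hcx := hc.self_of_nhds
  have hpos : ∀ᶠ t in 𝓝 x, ∀ i, 0 < c i t ^ 2 - 1 :=
    eventually_all.2 fun i =>
      (((hcx i).continuousAt.pow 2).sub continuousAt_const).eventually (lt_mem_nhds (h i))
  have heq : (fun t => deriv (fun s => ∑ i, 1 / √(c i s ^ 2 - 1)) t) =ᶠ[𝓝 x]
      fun t => ∑ i, -(c i t * c' i t) * (1 / √(c i t ^ 2 - 1)) ^ 3 := by
    filter_upwards [hc, hpos] with t h1 h2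
    exact (hasDerivAt_sum_inv_sqrt_sq_sub_one h1 h2).deriv
  rw [heq.deriv_eq]
  refine (HasDerivAt.fun_sum fun i _ => ?_).deriv
  refine HasDerivAt.congr_deriv ((((hcx i).fun_mul (hc' i)).fun_neg).fun_mul (((hcx i).inv_sqrt_sq_sub_one (h i)).fun_pow 3)) ?_
  push_cast
  ring

/-- The hyperbolic cosine of the distance between the points `(x, y, z)` and `p`. -/
def coshDist (p : ℝ × ℝ × ℝ) (x y z : ℝ) : ℝ :=
  1 + ((x - p.1) ^ 2 + (y - p.2.1) ^ 2 + (z - p.2.2) ^ 2) / (2 * z * p.2.2)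

theorem coshDist_sq_sub_one_pos {p q : ℝ × ℝ × ℝ} (hp : 0 < p.2.2) (hq : 0 < q.2.2)
    (h : p ≠ q) : 0 < coshDist p q.1 q.2.1 q.2.2 ^ 2 - 1 := by
  have hnum : 0 < (q.1 - p.1) ^ 2 + (q.2.1 - p.2.1) ^ 2 + (q.2.2 - p.2.2) ^ 2 := by
    refine lt_of_le_of_ne (by positivity) fun h0 => h ?_
    have h1 : q.1 - p.1 = 0 := by
      nlinarith [sq_nonneg (q.1 - p.1), sq_nonneg (q.2.1 - p.2.1), sq_nonneg (q.2.2 - p.2.2)]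
    have h2 : q.2.1 - p.2.1 = 0 := by
      nlinarith [sq_nonneg (q.1 - p.1), sq_nonneg (q.2.1 - p.2.1), sq_nonneg (q.2.2 - p.2.2)]
    have h3 : q.2.2 - p.2.2 = 0 := by
      nlinarith [sq_nonneg (q.1 - p.1), sq_nonneg (q.2.1 - p.2.1), sq_nonneg (q.2.2 - p.2.2)]
    exact Prod.ext (by linarith) (Prod.ext (by linarith) (by linarith))
  have hd := div_pos hnum (by positivity : 0 < 2 * q.2.2 * p.2.2)
  unfold coshDist
  nlinarith

theorem hasDerivAt_coshDist_fst (p : ℝ × ℝ × ℝ) (x y z : ℝ) :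
    HasDerivAt (fun t => coshDist p t y z) ((x - p.1) / (z * p.2.2)) x := by
  unfold coshDist
  refine HasDerivAt.congr_deriv ((((((((hasDerivAt_id x).sub_const p.1).fun_pow 2).add_const _).add_const _).div_const
    (2 * z * p.2.2)).const_add 1)) ?_
  norm_num
  rw [mul_assoc, mul_div_mul_left _ _ two_ne_zero]

theorem hasDerivAt_coshDist_snd (p : ℝ × ℝ × ℝ) (x y z : ℝ) :
    HasDerivAt (fun t => coshDist p x t z) ((y - p.2.1) / (z * p.2.2)) y := by
  unfold coshDist
  refine HasDerivAt.congr_deriv ((((((((hasDerivAt_id y).sub_const p.2.1).fun_pow 2).const_add _).add_const _).div_const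
    (2 * z * p.2.2)).const_add 1)) ?_
  norm_num
  rw [mul_assoc, mul_div_mul_left _ _ two_ne_zero]

theorem hasDerivAt_coshDist_trd {p : ℝ × ℝ × ℝ} {z : ℝ} (x y : ℝ) (hp : p.2.2 ≠ 0)
    (hz : z ≠ 0) :
    HasDerivAt (fun t => coshDist p x y t)
      ((1 - ((x - p.1) ^ 2 + (y - p.2.1) ^ 2 + p.2.2 ^ 2) / z ^ 2) / (2 * p.2.2)) z := by
  unfold coshDist
  refine HasDerivAt.congr_deriv ((((((hasDerivAt_id z).sub_const p.2.2).fun_pow 2).const_add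
    ((x - p.1) ^ 2 + (y - p.2.1) ^ 2)).fun_div (((hasDerivAt_id z).const_mul 2).mul_const p.2.2)
    (by simp [hp, hz])).const_add 1) ?_
  simp only [id]
  field_simp
  push_cast
  ring

theorem hasDerivAt_one_sub_div_sq (a b : ℝ) {z : ℝ} (hz : z ≠ 0) :
    HasDerivAt (fun t => (1 - a / t ^ 2) / b) (2 * a / z ^ 3 / b) z := by
  refine HasDerivAt.congr_deriv ((((hasDerivAt_const z a).fun_div (hasDerivAt_pow 2 z) (pow_ne_zero 2 hz)).const_sub
    1).div_const b) ?_
  congr 1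
  field_simp
  norm_num
  ring

/-- Superposition of singular Abelian hyperbolic monopoles: for distinct points
`p₁, …, p_n` of the upper half-space, the function `Λ = Σᵢ 1/sinh d(p,pᵢ)`
(written via `cosh d(p,pᵢ) = cᵢ`) is smooth and solves the hyperbolic Helmholtz
equation `L Λ + Λ = 0` away from the points `pᵢ`. -/
theorem helmholtz_sum_inv_sinh_dist (n : ℕ) (p : Fin n → ℝ × ℝ × ℝ)
    (hz : ∀ i, 0 < (p i).2.2) (hinj : Function.Injective p) :
    let c : Fin n → ℝ → ℝ → ℝ → ℝ := fun i x y z =>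
      1 + ((x - (p i).1) ^ 2 + (y - (p i).2.1) ^ 2 + (z - (p i).2.2) ^ 2)
        / (2 * z * (p i).2.2)
    let Λ : ℝ → ℝ → ℝ → ℝ := fun x y z =>
      ∑ i, 1 / Real.sqrt ((c i x y z) ^ 2 - 1)
    let U : Set (ℝ × ℝ × ℝ) := {q | 0 < q.2.2} \ Set.range p
    ContDiffOn ℝ (⊤ : ℕ∞) (fun q : ℝ × ℝ × ℝ => Λ q.1 q.2.1 q.2.2) U ∧
      ∀ q ∈ U, hypLap Λ q.1 q.2.1 q.2.2 + Λ q.1 q.2.1 q.2.2 = 0 := by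
  intro c Λ U
  have hpos : ∀ q ∈ U, ∀ i, 0 < c i q.1 q.2.1 q.2.2 ^ 2 - 1 := fun q hq i =>
    coshDist_sq_sub_one_pos (hz i) hq.1 fun h => hq.2 ⟨i, h⟩
  refine ⟨fun q hq => ContDiffAt.contDiffWithinAt ?_, fun q hq => ?_⟩
  · have hq0 : 0 < q.2.2 := hq.1
    refine ContDiffAt.sum fun i _ => ?_
    have hi := hpos q hq i
    have hzi := hz i
    have hc : ContDiffAt ℝ (⊤ : ℕ∞) (fun q : ℝ × ℝ × ℝ => c i q.1 q.2.1 q.2.2) q :=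
      contDiffAt_const.add (ContDiffAt.div (by fun_prop) (by fun_prop) (by positivity))
    exact contDiffAt_const.div (((hc.pow 2).sub contDiffAt_const).sqrt hi.ne')
      (Real.sqrt_pos.2 hi).ne'
  · have hq' := hpos q hq
    obtain ⟨x, y, z⟩ := q
    have hz0 : 0 < z := hq.1
    have h1 : pd1 (pd1 Λ) x y z = _ := deriv_deriv_sum_inv_sqrt_sq_sub_one
      (c := fun i t => c i t y z)
      (Eventually.of_forall fun t i => hasDerivAt_coshDist_fst (p i) t y z)
      (fun i => ((hasDerivAt_id x).sub_const (p i).1).div_const _) hq'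
    have h2 : pd2 (pd2 Λ) x y z = _ := deriv_deriv_sum_inv_sqrt_sq_sub_one
      (c := fun i t => c i x t z)
      (Eventually.of_forall fun t i => hasDerivAt_coshDist_snd (p i) x t z)
      (fun i => ((hasDerivAt_id y).sub_const (p i).2.1).div_const _) hq'
    have h3 : pd3 (pd3 Λ) x y z = _ := deriv_deriv_sum_inv_sqrt_sq_sub_one
      (c := fun i t => c i x y t)
      ((lt_mem_nhds hz0).mono fun t ht i =>
        hasDerivAt_coshDist_trd x y (hz i).ne' (ne_of_gt ht))
      (fun i => hasDerivAt_one_sub_div_sq _ _ hz0.ne') hq'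
    have h4 : pd3 Λ x y z = _ := (hasDerivAt_sum_inv_sqrt_sq_sub_one
      (c := fun i t => c i x y t)
      (fun i => hasDerivAt_coshDist_trd x y (hz i).ne' hz0.ne') hq').deriv
    simp only [hypLap, h1, h2, h3, h4]
    simp only [Λ, Finset.mul_sum, ← Finset.sum_add_distrib, ← Finset.sum_sub_distrib]
    refine Finset.sum_eq_zero fun i _ => ?_
    have hi : 0 < c i x y z ^ 2 - 1 := hq' i
    have hs : (1 / √(c i x y z ^ 2 - 1)) ^ 2 * (c i x y z ^ 2 - 1) = 1 := by
      rw [div_pow, Real.sq_sqrt hi.le]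
      field_simp
    have hzi := (hz i).ne'
    have hz0' := hz0.ne'
    have hgrad : z ^ 2 * (((x - (p i).1) / (z * (p i).2.2)) ^ 2
        + ((y - (p i).2.1) / (z * (p i).2.2)) ^ 2
        + ((1 - ((x - (p i).1) ^ 2 + (y - (p i).2.1) ^ 2 + (p i).2.2 ^ 2) / z ^ 2)
          / (2 * (p i).2.2)) ^ 2) = c i x y z ^ 2 - 1 := by
      simp only [c]
      field_simp
      ring
    have hlap : z ^ 2 * (1 / (z * (p i).2.2) + 1 / (z * (p i).2.2)
        + 2 * ((x - (p i).1) ^ 2 + (y - (p i).2.1) ^ 2 + (p i).2.2 ^ 2) / z ^ 3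
          / (2 * (p i).2.2))
        - z * ((1 - ((x - (p i).1) ^ 2 + (y - (p i).2.1) ^ 2 + (p i).2.2 ^ 2) / z ^ 2)
          / (2 * (p i).2.2)) = 3 * c i x y z := by
      simp only [c]
      field_simp
      ring
    generalize 1 / √(c i x y z ^ 2 - 1) = s at *
    generalize c i x y z = C at *
    linear_combination (-s ^ 3 + 3 * C ^ 2 * s ^ 5) * hgrad - C * s ^ 3 * hlap
      + (3 * C ^ 2 * s ^ 3 - s) * hs
end
end

section
/- Fix p₀ = (x₀,y₀,z₀) in the upper half-space (z₀ > 0). For p = (x,y,z) with z > 0 let c(p) = 1 + ((x−x₀)² + (y−y₀)² + (z−z₀)²)/(2 z z₀) (the hyperbolic cosine of the hyperbolic distance d(p,p₀)), and define the hyperbolic Green's function G(p) = 1/(e^{2d(p,p₀)} − 1) = ((c(p) + √(c(p)² − 1))² − 1)^{−1}. Then G is harmonic for the hyperbolic metric, i.e. L G = 0 on the upper half-space minus {p₀}. -/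
noncomputable section

/-- The Green's function as a function of `c = cosh d`. -/
def greenProfile (c : ℝ) : ℝ := ((c + Real.sqrt (c ^ 2 - 1)) ^ 2 - 1)⁻¹

theorem hasDerivAt_sqrt_sq_sub_one {c : ℝ} (hc : 1 < c) :
    HasDerivAt (fun t : ℝ => Real.sqrt (t ^ 2 - 1)) (c / Real.sqrt (c ^ 2 - 1)) c := by
  have h : HasDerivAt (fun t : ℝ => t ^ 2 - 1) (2 * c) c := by
    simpa using (hasDerivAt_pow 2 c).sub_const 1
  convert h.sqrt (by nlinarith) using 1
  ring

theorem hasDerivAt_greenProfile {c : ℝ} (hc : 1 < c) :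
    HasDerivAt greenProfile (-(1 / 2) * (Real.sqrt (c ^ 2 - 1) ^ 3)⁻¹) c := by
  have hs : 0 < Real.sqrt (c ^ 2 - 1) := Real.sqrt_pos.2 (by nlinarith)
  have hsq : Real.sqrt (c ^ 2 - 1) ^ 2 = c ^ 2 - 1 := Real.sq_sqrt (by nlinarith)
  have hd := hasDerivAt_sqrt_sq_sub_one hc
  set s := Real.sqrt (c ^ 2 - 1) with hs_def
  have hfac : (c + s) ^ 2 - 1 = 2 * s * (c + s) := by linear_combination -hsq
  have hcs : 0 < c + s := by linarith
  have h := ((((hasDerivAt_id c).add hd).pow 2).sub_const 1).inv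
    (by simp only [Pi.add_apply, Pi.pow_apply, id, ← hs_def]; rw [hfac]; positivity)
  refine HasDerivAt.congr_deriv h ?_
  simp only [Pi.add_apply, Pi.pow_apply, id, ← hs_def]
  rw [hfac]
  field_simp
  norm_num
  ring

theorem hasDerivAt_inv_sqrt_sq_sub_one_cube {c : ℝ} (hc : 1 < c) :
    HasDerivAt (fun t : ℝ => -(1 / 2) * (Real.sqrt (t ^ 2 - 1) ^ 3)⁻¹)
      (3 / 2 * c * (Real.sqrt (c ^ 2 - 1) ^ 5)⁻¹) c := by
  have hs : 0 < Real.sqrt (c ^ 2 - 1) := Real.sqrt_pos.2 (by nlinarith)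
  have h := (((hasDerivAt_sqrt_sq_sub_one hc).pow 3).inv
    (by simp only [Pi.pow_apply]; positivity)).const_mul (-(1 / 2))
  refine HasDerivAt.congr_deriv h ?_
  simp only [Pi.pow_apply]
  field_simp
  norm_num
  ring

theorem deriv_greenProfile_comp {u : ℝ → ℝ} {u' a : ℝ} (hu : HasDerivAt u u' a) (ha : 1 < u a) :
    deriv (fun t => greenProfile (u t)) a = -(1 / 2) * (Real.sqrt (u a ^ 2 - 1) ^ 3)⁻¹ * u' :=
  ((hasDerivAt_greenProfile ha).comp a hu).deriv

open Filter Topology in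
theorem deriv_deriv_greenProfile_comp {u u' : ℝ → ℝ} {u'' a : ℝ}
    (hu : ∀ᶠ t in 𝓝 a, HasDerivAt u (u' t) t) (hu' : HasDerivAt u' u'' a) (ha : 1 < u a) :
    deriv (fun s => deriv (fun t => greenProfile (u t)) s) a =
      3 / 2 * u a * (Real.sqrt (u a ^ 2 - 1) ^ 5)⁻¹ * u' a ^ 2 +
        -(1 / 2) * (Real.sqrt (u a ^ 2 - 1) ^ 3)⁻¹ * u'' := by
  have hev : (fun s => deriv (fun t => greenProfile (u t)) s) =ᶠ[𝓝 a]
      fun s => -(1 / 2) * (Real.sqrt (u s ^ 2 - 1) ^ 3)⁻¹ * u' s := by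
    filter_upwards [hu, hu.self_of_nhds.continuousAt.eventually_const_lt ha] with s h1 h2
    exact deriv_greenProfile_comp h1 h2
  rw [hev.deriv_eq]
  have h := ((hasDerivAt_inv_sqrt_sq_sub_one_cube ha).comp a hu.self_of_nhds).mul hu'
  refine h.deriv.trans ?_
  simp only [Function.comp_apply]
  ring

theorem hasDerivAt_sq_sub_div (b k m a : ℝ) :
    HasDerivAt (fun t : ℝ => 1 + ((t - b) ^ 2 + k) / m) (2 * (a - b) / m) a := by
  simpa using (((((hasDerivAt_id a).sub_const b).pow 2).add_const k).div_const m).const_add 1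

theorem hasDerivAt_two_mul_sub_div (b m a : ℝ) :
    HasDerivAt (fun t : ℝ => 2 * (t - b) / m) (2 / m) a := by
  simpa using (((hasDerivAt_id a).sub_const b).const_mul 2).div_const m

theorem hasDerivAt_height {z₀ k t : ℝ} (hz₀ : 0 < z₀) (ht : 0 < t) :
    HasDerivAt (fun t : ℝ => 1 + (k + (t - z₀) ^ 2) / (2 * t * z₀))
      (1 / (2 * z₀) - (k + z₀ ^ 2) / (2 * z₀) * (t ^ 2)⁻¹) t := by
  have h := ((((((hasDerivAt_id t).sub_const z₀).pow 2).const_add k).div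
    (((hasDerivAt_id t).const_mul 2).mul_const z₀)
    (by simp only [id]; positivity))).const_add 1
  refine HasDerivAt.congr_deriv h ?_
  simp only [Pi.pow_apply, id]
  field_simp
  norm_num
  ring

theorem hasDerivAt_deriv_height {z₀ k t : ℝ} (ht : 0 < t) :
    HasDerivAt (fun t : ℝ => 1 / (2 * z₀) - (k + z₀ ^ 2) / (2 * z₀) * (t ^ 2)⁻¹)
      ((k + z₀ ^ 2) / z₀ * (t ^ 3)⁻¹) t := by
  have h := (((hasDerivAt_pow 2 t).inv (by positivity)).const_mul
    ((k + z₀ ^ 2) / (2 * z₀))).const_sub (1 / (2 * z₀))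
  refine HasDerivAt.congr_deriv h ?_
  field_simp
  norm_num

/-- The hyperbolic Green's function `G(p) = 1/(e^{2d(p,p₀)} − 1)
= ((c + √(c² − 1))² − 1)⁻¹`, where `c = cosh d(p,p₀)`, is harmonic for the
hyperbolic metric on the upper half-space minus the point `p₀`. -/
theorem hyperbolic_green_function_harmonic (x₀ y₀ z₀ : ℝ) (hz₀ : 0 < z₀) :
    let c : ℝ → ℝ → ℝ → ℝ := fun x y z =>
      1 + ((x - x₀) ^ 2 + (y - y₀) ^ 2 + (z - z₀) ^ 2) / (2 * z * z₀)
    let G : ℝ → ℝ → ℝ → ℝ := fun x y z =>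
      ((c x y z + Real.sqrt ((c x y z) ^ 2 - 1)) ^ 2 - 1)⁻¹
    ∀ x y z : ℝ, 0 < z → (x, y, z) ≠ (x₀, y₀, z₀) →
      hypLap G x y z = 0 := by
  intro c G x y z hz hne
  have hpos : 0 < (x - x₀) ^ 2 + (y - y₀) ^ 2 + (z - z₀) ^ 2 := by
    by_contra! h
    apply hne
    have hx : x - x₀ = 0 := by nlinarith [sq_nonneg (x - x₀), sq_nonneg (y - y₀), sq_nonneg (z - z₀)]
    have hy : y - y₀ = 0 := by nlinarith [sq_nonneg (x - x₀), sq_nonneg (y - y₀), sq_nonneg (z - z₀)]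
    have hz : z - z₀ = 0 := by nlinarith [sq_nonneg (x - x₀), sq_nonneg (y - y₀), sq_nonneg (z - z₀)]
    rw [sub_eq_zero.1 hx, sub_eq_zero.1 hy, sub_eq_zero.1 hz]
  have hc : 1 < c x y z := lt_add_of_pos_right 1 (by positivity)
  have hx : ∀ t, HasDerivAt (fun t => c t y z) (2 * (t - x₀) / (2 * z * z₀)) t := fun t => by
    convert hasDerivAt_sq_sub_div x₀ ((y - y₀) ^ 2 + (z - z₀) ^ 2) (2 * z * z₀) t using 2
    simp only [c]; ring
  have hy : ∀ t, HasDerivAt (fun t => c x t z) (2 * (t - y₀) / (2 * z * z₀)) t := fun t => by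
    convert hasDerivAt_sq_sub_div y₀ ((x - x₀) ^ 2 + (z - z₀) ^ 2) (2 * z * z₀) t using 2
    simp only [c]; ring
  have h1 : pd1 (pd1 G) x y z = _ :=
    deriv_deriv_greenProfile_comp (.of_forall hx) (hasDerivAt_two_mul_sub_div _ _ x) hc
  have h2 : pd2 (pd2 G) x y z = _ :=
    deriv_deriv_greenProfile_comp (.of_forall hy) (hasDerivAt_two_mul_sub_div _ _ y) hc
  have hzd : ∀ t, 0 < t → HasDerivAt (fun t => c x y t) _ t :=
    fun t ht => hasDerivAt_height (k := (x - x₀) ^ 2 + (y - y₀) ^ 2) hz₀ ht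
  have h3 : pd3 (pd3 G) x y z = _ :=
    deriv_deriv_greenProfile_comp ((eventually_gt_nhds hz).mono hzd)
      (hasDerivAt_deriv_height hz) hc
  have h4 : pd3 G x y z = _ := deriv_greenProfile_comp (hzd z hz) hc
  rw [hypLap, h1, h2, h3, h4]
  have hs : 0 < Real.sqrt (c x y z ^ 2 - 1) := Real.sqrt_pos.2 (by nlinarith)
  have hsq : Real.sqrt (c x y z ^ 2 - 1) ^ 2 = c x y z ^ 2 - 1 := Real.sq_sqrt (by nlinarith)
  set s := Real.sqrt (c x y z ^ 2 - 1)
  set k := (x - x₀) ^ 2 + (y - y₀) ^ 2 with hk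
  have hcz : c x y z = 1 + (k + (z - z₀) ^ 2) / (2 * z * z₀) := rfl
  have hgrad : z ^ 2 * ((2 * (x - x₀) / (2 * z * z₀)) ^ 2 + (2 * (y - y₀) / (2 * z * z₀)) ^ 2 +
      (1 / (2 * z₀) - (k + z₀ ^ 2) / (2 * z₀) * (z ^ 2)⁻¹) ^ 2) = s ^ 2 := by
    rw [hsq, hcz, hk]
    field_simp
    ring
  have hlap : z ^ 2 * (2 / (2 * z * z₀) + 2 / (2 * z * z₀) + (k + z₀ ^ 2) / z₀ * (z ^ 3)⁻¹) -
      z * (1 / (2 * z₀) - (k + z₀ ^ 2) / (2 * z₀) * (z ^ 2)⁻¹) = 3 * c x y z := by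
    rw [hcz]
    field_simp
    ring
  have hs5 : (s ^ 5)⁻¹ * s ^ 2 = (s ^ 3)⁻¹ := by field_simp
  linear_combination 3 / 2 * c x y z * (s ^ 5)⁻¹ * hgrad - 1 / 2 * (s ^ 3)⁻¹ * hlap +
    3 / 2 * c x y z * hs5
end
end

section
/- Let U be an open subset of the upper half-space {z > 0} and let Ω, ρ : U → ℝ be smooth with Ω > 0. Then the Leibniz identity L(ρΩ) + ρΩ = Ω·[L ρ + (2z²/Ω)(∂ₓρ ∂ₓΩ + ∂_yρ ∂_yΩ + ∂_zρ ∂_zΩ)] + ρ·[L Ω + Ω] holds on U. In particular, if Ω satisfies the hyperbolic Helmholtz equation L Ω + Ω = 0 and ρ satisfies L ρ + (2z²/Ω)(∂ₓρ ∂ₓΩ + ∂_yρ ∂_yΩ + ∂_zρ ∂_zΩ) = 0 (i.e. ρ is harmonic with respect to the conformally rescaled geometry), then Λ = ρΩ satisfies the hyperbolic Helmholtz equation L Λ + Λ = 0. -/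
noncomputable section

/-- The second-order Leibniz rule for a product of two real functions. -/
theorem deriv_deriv_mul_of_contDiffAt {f g : ℝ → ℝ} {x : ℝ}
    (hf : ContDiffAt ℝ 2 f x) (hg : ContDiffAt ℝ 2 g x) :
    deriv (deriv fun t => f t * g t) x
      = deriv (deriv f) x * g x + 2 * (deriv f x * deriv g x) + f x * deriv (deriv g) x := by
  have h_deriv : deriv (fun t => f t * g t) =ᶠ[nhds x] fun t => deriv f t * g t + f t * deriv g t := by
    filter_upwards [hf.eventually (by simp), hg.eventually (by simp)] with t hft hgt
    exact deriv_fun_mul (hft.differentiableAt (by simp)) (hgt.differentiableAt (by simp))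
  have hf₀ : DifferentiableAt ℝ f x := hf.differentiableAt (by simp)
  have hg₀ : DifferentiableAt ℝ g x := hg.differentiableAt (by simp)
  have hf₁ : DifferentiableAt ℝ (deriv f) x :=
    (hf.derivWithin (m := 1) (by norm_num)).differentiableAt (by simp)
  have hg₁ : DifferentiableAt ℝ (deriv g) x :=
    (hg.derivWithin (m := 1) (by norm_num)).differentiableAt (by simp)
  rw [h_deriv.deriv_eq, deriv_fun_add (hf₁.fun_mul hg₀) (hf₀.fun_mul hg₁), deriv_fun_mul hf₁ hg₀,
    deriv_fun_mul hf₀ hg₁]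
  ring

/-- The Leibniz rule for the hyperbolic Laplacian. -/
theorem hypLap_mul {f g : ℝ → ℝ → ℝ → ℝ} {x y z : ℝ}
    (hf : ContDiffAt ℝ 2 (fun q : ℝ × ℝ × ℝ => f q.1 q.2.1 q.2.2) (x, y, z))
    (hg : ContDiffAt ℝ 2 (fun q : ℝ × ℝ × ℝ => g q.1 q.2.1 q.2.2) (x, y, z)) :
    hypLap (fun a b c => f a b c * g a b c) x y z
      = hypLap f x y z * g x y z
        + 2 * z ^ 2 * (pd1 f x y z * pd1 g x y z + pd2 f x y z * pd2 g x y z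
          + pd3 f x y z * pd3 g x y z)
        + f x y z * hypLap g x y z := by
  have slice₁ {h : ℝ → ℝ → ℝ → ℝ}
      (hh : ContDiffAt ℝ 2 (fun q : ℝ × ℝ × ℝ => h q.1 q.2.1 q.2.2) (x, y, z)) :
      ContDiffAt ℝ 2 (fun t => h t y z) x :=
    hh.comp (f := fun t : ℝ => (t, y, z)) x (by fun_prop)
  have slice₂ {h : ℝ → ℝ → ℝ → ℝ}
      (hh : ContDiffAt ℝ 2 (fun q : ℝ × ℝ × ℝ => h q.1 q.2.1 q.2.2) (x, y, z)) :
      ContDiffAt ℝ 2 (fun t => h x t z) y :=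
    hh.comp (f := fun t : ℝ => (x, t, z)) y (by fun_prop)
  have slice₃ {h : ℝ → ℝ → ℝ → ℝ}
      (hh : ContDiffAt ℝ 2 (fun q : ℝ × ℝ × ℝ => h q.1 q.2.1 q.2.2) (x, y, z)) :
      ContDiffAt ℝ 2 (fun t => h x y t) z :=
    hh.comp (f := fun t : ℝ => (x, y, t)) z (by fun_prop)
  have h₁ := deriv_deriv_mul_of_contDiffAt (slice₁ hf) (slice₁ hg)
  have h₂ := deriv_deriv_mul_of_contDiffAt (slice₂ hf) (slice₂ hg)
  have h₃ := deriv_deriv_mul_of_contDiffAt (slice₃ hf) (slice₃ hg)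
  have h_pd3 : deriv (fun t => f x y t * g x y t) z
      = deriv (fun t => f x y t) z * g x y z + f x y z * deriv (fun t => g x y t) z :=
    deriv_fun_mul ((slice₃ hf).differentiableAt (by simp)) ((slice₃ hg).differentiableAt (by simp))
  change z ^ 2 * (deriv (deriv fun t => f t y z * g t y z) x
      + deriv (deriv fun t => f x t z * g x t z) y
      + deriv (deriv fun t => f x y t * g x y t) z)
    - z * deriv (fun t => f x y t * g x y t) z = _
  rw [h₁, h₂, h₃, h_pd3]
  unfold hypLap pd1 pd2 pd3
  ring

/-- The solution-generating (Bäcklund-type) method: for smooth `Ω > 0` and `ρ` on an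
open subset `U` of the upper half-space, the Leibniz identity
`L(ρΩ) + ρΩ = Ω·[Lρ + (2z²/Ω)∇ρ·∇Ω] + ρ·[LΩ + Ω]` holds on `U`; in particular if
`Ω` solves the hyperbolic Helmholtz equation and `ρ` is harmonic for the conformally
rescaled geometry then `Λ = ρΩ` solves the hyperbolic Helmholtz equation. -/
theorem helmholtz_backlund (U : Set (ℝ × ℝ × ℝ)) (hU : IsOpen U)
    (hUz : ∀ q ∈ U, 0 < q.2.2)
    (Ω ρ : ℝ → ℝ → ℝ → ℝ)
    (hΩ : ContDiffOn ℝ (⊤ : ℕ∞) (fun q : ℝ × ℝ × ℝ => Ω q.1 q.2.1 q.2.2) U)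
    (hρ : ContDiffOn ℝ (⊤ : ℕ∞) (fun q : ℝ × ℝ × ℝ => ρ q.1 q.2.1 q.2.2) U)
    (hΩpos : ∀ q ∈ U, 0 < Ω q.1 q.2.1 q.2.2) :
    (∀ q ∈ U, ∀ x y z : ℝ, q = (x, y, z) →
      hypLap (fun a b c => ρ a b c * Ω a b c) x y z + ρ x y z * Ω x y z
        = Ω x y z * (hypLap ρ x y z
            + (2 * z ^ 2 / Ω x y z) * (pd1 ρ x y z * pd1 Ω x y z
                + pd2 ρ x y z * pd2 Ω x y z + pd3 ρ x y z * pd3 Ω x y z))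
          + ρ x y z * (hypLap Ω x y z + Ω x y z)) ∧
    ((∀ q ∈ U, hypLap Ω q.1 q.2.1 q.2.2 + Ω q.1 q.2.1 q.2.2 = 0) →
     (∀ q ∈ U, hypLap ρ q.1 q.2.1 q.2.2
        + (2 * q.2.2 ^ 2 / Ω q.1 q.2.1 q.2.2)
          * (pd1 ρ q.1 q.2.1 q.2.2 * pd1 Ω q.1 q.2.1 q.2.2
            + pd2 ρ q.1 q.2.1 q.2.2 * pd2 Ω q.1 q.2.1 q.2.2
            + pd3 ρ q.1 q.2.1 q.2.2 * pd3 Ω q.1 q.2.1 q.2.2) = 0) →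
     ∀ q ∈ U, hypLap (fun a b c => ρ a b c * Ω a b c) q.1 q.2.1 q.2.2
        + ρ q.1 q.2.1 q.2.2 * Ω q.1 q.2.1 q.2.2 = 0) := by
  have leibniz : ∀ q ∈ U, ∀ x y z : ℝ, q = (x, y, z) →
      hypLap (fun a b c => ρ a b c * Ω a b c) x y z + ρ x y z * Ω x y z
        = Ω x y z * (hypLap ρ x y z
            + (2 * z ^ 2 / Ω x y z) * (pd1 ρ x y z * pd1 Ω x y z
                + pd2 ρ x y z * pd2 Ω x y z + pd3 ρ x y z * pd3 Ω x y z))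
          + ρ x y z * (hypLap Ω x y z + Ω x y z) := by
    rintro q hq x y z rfl
    have hΩ_ne : Ω x y z ≠ 0 := (hΩpos _ hq).ne'
    have h_le : (2 : WithTop ℕ∞) ≤ ((⊤ : ℕ∞) : WithTop ℕ∞) :=
      WithTop.coe_le_coe.2 (le_top (a := (2 : ℕ∞)))
    rw [hypLap_mul ((hρ.contDiffAt (hU.mem_nhds hq)).of_le h_le)
      ((hΩ.contDiffAt (hU.mem_nhds hq)).of_le h_le)]
    field_simp
    ring
  refine ⟨leibniz, fun hΩ_helm hρ_harm q hq => ?_⟩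
  rw [leibniz q hq q.1 q.2.1 q.2.2 rfl, hΩ_helm q hq, hρ_harm q hq]
  ring
end
end

section
/- Let u₀ > 0, r > 0 and θ ∈ (0,π). Set u = u₀ √(1/sinh²r + cos²θ) and cos χ = cosh r · cos θ / √(cosh²r cos²θ + sin²θ) (the angle χ ∈ (0,π) determined by tan χ = tan θ / cosh r). Then u² + u₀² + 2 u u₀ cos χ = u₀² (coth r + cos θ)² and u² + u₀² − 2 u u₀ cos χ = u₀² (coth r − cos θ)², so that u₊ = u₀(coth r + cos θ) and u₋ = u₀(coth r − cos θ); consequently the Gibbons–Hawking potential 𝒱 = 1/u₊ + 1/u₋ of Eguchi–Hanson space, expressed in the coordinates (r,θ), equals 𝒱 = 2 sinh r cosh r / (u₀ (1 + sinh²r sin²θ)). -/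
open Real

/-- The Eguchi–Hanson Gibbons–Hawking potential `𝒱 = 1/u₊ + 1/u₋` expressed in the
hyperbolic coordinates `(r,θ)`: with `u = u₀√(1/sinh²r + cos²θ)` and
`cos χ = cosh r cos θ/√(cosh²r cos²θ + sin²θ)` one has
`u² + u₀² ± 2uu₀cos χ = u₀²(coth r ± cos θ)²`, so `u_± = u₀(coth r ± cos θ)` and
`𝒱 = 2 sinh r cosh r/(u₀(1 + sinh²r sin²θ))`. -/
theorem eguchi_hanson_potential_hyperbolic_coords (u₀ r θ : ℝ)
    (hu₀ : 0 < u₀) (hr : 0 < r) (hθ : θ ∈ Set.Ioo 0 π) :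
    let u : ℝ := u₀ * Real.sqrt (1 / Real.sinh r ^ 2 + Real.cos θ ^ 2)
    let cχ : ℝ := Real.cosh r * Real.cos θ
      / Real.sqrt (Real.cosh r ^ 2 * Real.cos θ ^ 2 + Real.sin θ ^ 2)
    let coth : ℝ := Real.cosh r / Real.sinh r
    u ^ 2 + u₀ ^ 2 + 2 * u * u₀ * cχ = u₀ ^ 2 * (coth + Real.cos θ) ^ 2 ∧
    u ^ 2 + u₀ ^ 2 - 2 * u * u₀ * cχ = u₀ ^ 2 * (coth - Real.cos θ) ^ 2 ∧
    Real.sqrt (u ^ 2 + u₀ ^ 2 + 2 * u * u₀ * cχ) = u₀ * (coth + Real.cos θ) ∧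
    Real.sqrt (u ^ 2 + u₀ ^ 2 - 2 * u * u₀ * cχ) = u₀ * (coth - Real.cos θ) ∧
    1 / Real.sqrt (u ^ 2 + u₀ ^ 2 + 2 * u * u₀ * cχ)
      + 1 / Real.sqrt (u ^ 2 + u₀ ^ 2 - 2 * u * u₀ * cχ)
      = 2 * Real.sinh r * Real.cosh r
        / (u₀ * (1 + Real.sinh r ^ 2 * Real.sin θ ^ 2)) := by
  intro u cχ coth
  have hs : 0 < Real.sinh r := Real.sinh_pos_iff.mpr hr
  have hcs : Real.cosh r ^ 2 = Real.sinh r ^ 2 + 1 := Real.cosh_sq r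
  have hsin : Real.sin θ ^ 2 = 1 - Real.cos θ ^ 2 := Real.sin_sq θ
  have hsc : Real.sinh r < Real.cosh r := Real.sinh_lt_cosh r
  have hcoth : 1 < coth := (one_lt_div hs).mpr hsc
  have hD : 0 < Real.cosh r ^ 2 * Real.cos θ ^ 2 + Real.sin θ ^ 2 := by
    rw [hcs, hsin]
    nlinarith [sq_nonneg (Real.sinh r * Real.cos θ)]
  have hu : u = u₀ * (Real.sqrt (Real.cosh r ^ 2 * Real.cos θ ^ 2 + Real.sin θ ^ 2)
      / Real.sinh r) := by
    have h : 1 / Real.sinh r ^ 2 + Real.cos θ ^ 2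
        = (Real.cosh r ^ 2 * Real.cos θ ^ 2 + Real.sin θ ^ 2) / Real.sinh r ^ 2 := by
      rw [hcs, hsin]
      field_simp
      ring
    simp only [u]
    rw [h, Real.sqrt_div hD.le, Real.sqrt_sq hs.le]
  have hcross : u * cχ = u₀ * (coth * Real.cos θ) := by
    have hne := (Real.sqrt_pos.mpr hD).ne'
    rw [hu]
    simp only [cχ, coth]
    field_simp
  have hcoth_sq : coth ^ 2 = 1 / Real.sinh r ^ 2 + 1 := by
    simp only [coth]
    rw [div_pow, hcs]
    field_simp
    ring
  have husq : u ^ 2 = u₀ ^ 2 * (coth ^ 2 - 1 + Real.cos θ ^ 2) := by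
    simp only [u]
    rw [mul_pow, Real.sq_sqrt (by positivity), hcoth_sq]
    ring
  have hplus : u ^ 2 + u₀ ^ 2 + 2 * u * u₀ * cχ = u₀ ^ 2 * (coth + Real.cos θ) ^ 2 := by
    linear_combination husq + 2 * u₀ * hcross
  have hminus : u ^ 2 + u₀ ^ 2 - 2 * u * u₀ * cχ = u₀ ^ 2 * (coth - Real.cos θ) ^ 2 := by
    linear_combination husq - 2 * u₀ * hcross
  have hp : 0 < coth + Real.cos θ := by linarith [Real.neg_one_le_cos θ]
  have hm : 0 < coth - Real.cos θ := by linarith [Real.cos_le_one θ]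
  have hsqrt_plus : Real.sqrt (u ^ 2 + u₀ ^ 2 + 2 * u * u₀ * cχ)
      = u₀ * (coth + Real.cos θ) := by
    rw [hplus, ← mul_pow, Real.sqrt_sq (by positivity)]
  have hsqrt_minus : Real.sqrt (u ^ 2 + u₀ ^ 2 - 2 * u * u₀ * cχ)
      = u₀ * (coth - Real.cos θ) := by
    rw [hminus, ← mul_pow, Real.sqrt_sq (by positivity)]
  refine ⟨hplus, hminus, hsqrt_plus, hsqrt_minus, ?_⟩
  rw [hsqrt_plus, hsqrt_minus, div_add_div _ _ (by positivity) (by positivity),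
    div_eq_div_iff (by positivity) (by positivity), hsin]
  have hc : Real.cosh r = coth * Real.sinh r := (div_mul_cancel₀ _ hs.ne').symm
  have hsq : coth ^ 2 * Real.sinh r ^ 2 = Real.sinh r ^ 2 + 1 := by
    rw [← mul_pow, ← hc, hcs]
  rw [hc]
  linear_combination (-2 * u₀ ^ 2 * coth) * hsq
end

section
/- The function Λ(r,θ) = 4 cosh r / (1 + sinh²r sin²θ) satisfies the hyperbolic Helmholtz equation Δ_{H³}Λ + Λ = 0 on the region r > 0, 0 < θ < π; that is, ∂²_rΛ + 2 coth r ∂_rΛ + (1/sinh²r)(∂²_θΛ + cot θ ∂_θΛ) + Λ = 0 there. -/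
noncomputable section

/-- Partial derivative in the radial coordinate `r`. -/
def pdr (f : ℝ → ℝ → ℝ) (r θ : ℝ) : ℝ := deriv (fun t => f t θ) r

/-- Partial derivative in the angular coordinate `θ`. -/
def pdθ (f : ℝ → ℝ → ℝ) (r θ : ℝ) : ℝ := deriv (fun t => f r t) θ

open Real in
lemma one_add_sinh_sq_mul_sin_sq_pos (r θ : ℝ) : 0 < 1 + sinh r ^ 2 * sin θ ^ 2 := by
  positivity

open Real in
lemma hasDerivAt_one_add_sinh_sq_mul_sin_sq_radial (r θ : ℝ) :
    HasDerivAt (fun t => 1 + sinh t ^ 2 * sin θ ^ 2) (2 * sinh r * cosh r * sin θ ^ 2) r := by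
  refine ((((hasDerivAt_sinh r).fun_pow 2).mul_const (sin θ ^ 2)).const_add 1).congr_deriv ?_
  norm_num

open Real in
lemma hasDerivAt_one_add_sinh_sq_mul_sin_sq_angular (r θ : ℝ) :
    HasDerivAt (fun t => 1 + sinh r ^ 2 * sin t ^ 2) (sinh r ^ 2 * (2 * sin θ * cos θ)) θ := by
  refine ((((hasDerivAt_sin θ).fun_pow 2).const_mul (sinh r ^ 2)).const_add 1).congr_deriv ?_
  norm_num

/-- The function `Λ(r,θ) = 4 cosh r/(1 + sinh²r sin²θ)`, arising from the
Eguchi–Hanson Gibbons–Hawking potential times the conformal factor `1/sinh r`,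
solves the hyperbolic Helmholtz equation
`∂²_rΛ + 2 coth r ∂_rΛ + (1/sinh²r)(∂²_θΛ + cot θ ∂_θΛ) + Λ = 0`
on the region `r > 0`, `0 < θ < π`. -/
theorem helmholtz_eguchi_hanson_solution :
    let Λ : ℝ → ℝ → ℝ := fun r θ =>
      4 * Real.cosh r / (1 + Real.sinh r ^ 2 * Real.sin θ ^ 2)
    ∀ r θ : ℝ, 0 < r → θ ∈ Set.Ioo 0 Real.pi →
      pdr (pdr Λ) r θ + 2 * (Real.cosh r / Real.sinh r) * pdr Λ r θ
        + (1 / Real.sinh r ^ 2)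
          * (pdθ (pdθ Λ) r θ + (Real.cos θ / Real.sin θ) * pdθ Λ r θ)
        + Λ r θ = 0 := by
  intro Λ r θ hr hθ
  have hS : Real.sinh r ≠ 0 := (Real.sinh_pos_iff.2 hr).ne'
  have hs : Real.sin θ ≠ 0 := (Real.sin_pos_of_pos_of_lt_pi hθ.1 hθ.2).ne'
  have hD (r θ : ℝ) := (one_add_sinh_sq_mul_sin_sq_pos r θ).ne'
  have hΛr : pdr Λ = fun r θ =>
      (4 * Real.sinh r * (1 + Real.sinh r ^ 2 * Real.sin θ ^ 2)
        - 4 * Real.cosh r * (2 * Real.sinh r * Real.cosh r * Real.sin θ ^ 2))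
        / (1 + Real.sinh r ^ 2 * Real.sin θ ^ 2) ^ 2 := by
    funext r θ
    exact (((Real.hasDerivAt_cosh r).const_mul 4).fun_div
      (hasDerivAt_one_add_sinh_sq_mul_sin_sq_radial r θ) (hD r θ)).deriv
  have hΛθ : pdθ Λ = fun r θ =>
      -(4 * Real.cosh r * (Real.sinh r ^ 2 * (2 * Real.sin θ * Real.cos θ)))
        / (1 + Real.sinh r ^ 2 * Real.sin θ ^ 2) ^ 2 := by
    funext r θ
    refine (((hasDerivAt_const θ (4 * Real.cosh r)).fun_div
      (hasDerivAt_one_add_sinh_sq_mul_sin_sq_angular r θ) (hD r θ)).congr_deriv ?_).deriv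
    simp
  have hΛrr := (((((Real.hasDerivAt_sinh r).const_mul 4).fun_mul
      (hasDerivAt_one_add_sinh_sq_mul_sin_sq_radial r θ)).fun_sub
    (((Real.hasDerivAt_cosh r).const_mul 4).fun_mul
      ((((Real.hasDerivAt_sinh r).const_mul 2).fun_mul (Real.hasDerivAt_cosh r)).mul_const
        (Real.sin θ ^ 2)))).fun_div
    ((hasDerivAt_one_add_sinh_sq_mul_sin_sq_radial r θ).fun_pow 2)
    (pow_ne_zero 2 (hD r θ))).deriv
  have hΛθθ := (((((((Real.hasDerivAt_sin θ).const_mul 2).fun_mul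
      (Real.hasDerivAt_cos θ)).const_mul (Real.sinh r ^ 2)).const_mul
        (4 * Real.cosh r)).fun_neg).fun_div
    ((hasDerivAt_one_add_sinh_sq_mul_sin_sq_angular r θ).fun_pow 2)
    (pow_ne_zero 2 (hD r θ))).deriv
  rw [hΛr, hΛθ]
  unfold pdr pdθ
  simp only [Λ]
  rw [hΛrr, hΛθθ]
  have hD' := hD r θ
  have hC : Real.cosh r ^ 2 = 1 + Real.sinh r ^ 2 := by rw [Real.cosh_sq]; ring
  have hc : Real.cos θ ^ 2 = 1 - Real.sin θ ^ 2 := Real.cos_sq' θ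
  generalize Real.cosh r = C at *
  generalize Real.sinh r = S at *
  generalize Real.sin θ = s at *
  generalize Real.cos θ = c at *
  norm_num
  field_simp
  grind
end
end

section
/- Let Λ(r,θ) = 4 cosh r / (1 + sinh²r sin²θ). Then for all r > 0 and θ ∈ (0,π) one has (∂_r log Λ)² + (1/sinh²r)(∂_θ log Λ)² = tanh²r. Consequently the Higgs field of the hyperbolic monopole generated by Λ, whose squared norm is ‖Φ‖² = (1/4)[(∂_r log Λ)² + (∂_θ log Λ)²/sinh²r], satisfies ‖Φ‖ = (1/2) tanh r: it is the smooth spherically symmetric charge-1 hyperbolic monopole of mass 1/2. -/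
noncomputable section

open Real in
/-- The radial derivative of `log (4 cosh r / (1 + sinh²r sin²θ))`. -/
lemma hasDerivAt_log_potential_radial (r θ : ℝ) :
    HasDerivAt (fun t => log (4 * cosh t / (1 + sinh t ^ 2 * sin θ ^ 2)))
      (sinh r / cosh r - 2 * sinh r * cosh r * sin θ ^ 2 / (1 + sinh r ^ 2 * sin θ ^ 2)) r := by
  have hC : cosh r ≠ 0 := (cosh_pos r).ne'
  have hD : 1 + sinh r ^ 2 * sin θ ^ 2 ≠ 0 := by positivity
  have hden := (((hasDerivAt_sinh r).pow 2).mul_const (sin θ ^ 2)).const_add 1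
  have h := (((hasDerivAt_cosh r).const_mul 4).div hden hD).log
    (div_ne_zero (mul_ne_zero four_ne_zero hC) hD)
  refine h.congr_deriv ?_
  simp only [Pi.pow_apply, Pi.div_apply]
  field_simp
  push_cast
  ring

open Real in
/-- The angular derivative of `log (4 cosh r / (1 + sinh²r sin²θ))`. -/
lemma hasDerivAt_log_potential_angular (r θ : ℝ) :
    HasDerivAt (fun t => log (4 * cosh r / (1 + sinh r ^ 2 * sin t ^ 2)))
      (-(2 * sinh r ^ 2 * sin θ * cos θ / (1 + sinh r ^ 2 * sin θ ^ 2))) θ := by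
  have hC : cosh r ≠ 0 := (cosh_pos r).ne'
  have hD : 1 + sinh r ^ 2 * sin θ ^ 2 ≠ 0 := by positivity
  have hden := (((hasDerivAt_sin θ).pow 2).const_mul (sinh r ^ 2)).const_add 1
  have h := ((hasDerivAt_const θ (4 * cosh r)).div hden hD).log
    (div_ne_zero (mul_ne_zero four_ne_zero hC) hD)
  refine h.congr_deriv ?_
  simp only [Pi.pow_apply, Pi.div_apply]
  field_simp
  push_cast
  ring

/-- For `Λ(r,θ) = 4 cosh r/(1 + sinh²r sin²θ)` one has
`(∂_r log Λ)² + (∂_θ log Λ)²/sinh²r = tanh²r`, hence the Higgs field norm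
`‖Φ‖ = √(‖Φ‖²) = (1/2) tanh r` of the smooth spherically symmetric charge-1
hyperbolic monopole of mass `1/2`. -/
theorem higgs_norm_eguchi_hanson_monopole :
    let Λ : ℝ → ℝ → ℝ := fun r θ =>
      4 * Real.cosh r / (1 + Real.sinh r ^ 2 * Real.sin θ ^ 2)
    let lg : ℝ → ℝ → ℝ := fun r θ => Real.log (Λ r θ)
    ∀ r θ : ℝ, 0 < r → θ ∈ Set.Ioo 0 Real.pi →
      (pdr lg r θ) ^ 2 + (pdθ lg r θ) ^ 2 / Real.sinh r ^ 2 = Real.tanh r ^ 2 ∧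
      Real.sqrt ((1 / 4) * ((pdr lg r θ) ^ 2 + (pdθ lg r θ) ^ 2 / Real.sinh r ^ 2))
        = (1 / 2) * Real.tanh r := by
  intro Λ lg r θ hr _
  have hS : 0 < Real.sinh r := Real.sinh_pos_iff.2 hr
  have hC : 0 < Real.cosh r := Real.cosh_pos r
  have hT : 0 ≤ Real.tanh r := by rw [Real.tanh_eq_sinh_div_cosh]; positivity
  have h : (pdr lg r θ) ^ 2 + (pdθ lg r θ) ^ 2 / Real.sinh r ^ 2 = Real.tanh r ^ 2 := by
    have h₁ := (hasDerivAt_log_potential_radial r θ).deriv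
    have h₂ := (hasDerivAt_log_potential_angular r θ).deriv
    simp only [pdr, pdθ, lg, Λ]
    rw [h₁, h₂, Real.tanh_eq_sinh_div_cosh]
    have hD : 1 + Real.sinh r ^ 2 * Real.sin θ ^ 2 ≠ 0 := by positivity
    field_simp
    have hc := Real.cos_sq' θ
    have hch := Real.cosh_sq r
    generalize Real.sinh r = S at *
    generalize Real.cosh r = C at *
    generalize Real.sin θ = s at *
    generalize Real.cos θ = c at *
    linear_combination (4 * C ^ 2 * s ^ 2) * hc + (4 * C ^ 2 * s ^ 4) * hch
  refine ⟨h, ?_⟩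
  rw [h, show (1 / 4) * Real.tanh r ^ 2 = ((1 / 2) * Real.tanh r) ^ 2 by ring]
  exact Real.sqrt_sq (by positivity)
end
end

section
/- Let ρ be a smooth positive function on an open subset of the upper half-space {z > 0} satisfying z²(∂²_xρ + ∂²_yρ + ∂²_zρ) + z ∂_zρ = 0 (i.e. ρ is a circle-invariant harmonic function on Euclidean 4-space, as in the JNR ansatz). Then the squared Higgs-field norm of the associated hyperbolic monopole satisfies (z²/(4ρ²))[(∂_xρ)² + (∂_yρ)² + (ρ/z + ∂_zρ)²] = −(1/4)(1 + L log(zρ)). -/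
open Filter Topology

theorem ContDiffAt.eventually_differentiableAt_of_two {g : ℝ → ℝ} {x : ℝ}
    (hg : ContDiffAt ℝ 2 g x) : ∀ᶠ t in 𝓝 x, DifferentiableAt ℝ g t :=
  (hg.eventually (by simp)).mono fun _ ht => ht.differentiableAt (by simp)

theorem ContDiffAt.differentiableAt_deriv_of_two {g : ℝ → ℝ} {x : ℝ}
    (hg : ContDiffAt ℝ 2 g x) : DifferentiableAt ℝ (deriv g) x := by
  have h : ContDiffAt ℝ 1 (fderiv ℝ g) x := hg.fderiv_right (by norm_num)
  exact (h.differentiableAt (by simp)).clm_apply (differentiableAt_const 1)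

theorem deriv_deriv_log_comp {g : ℝ → ℝ} {x : ℝ} (hg : ContDiffAt ℝ 2 g x) (hx : g x ≠ 0) :
    deriv (fun s => deriv (fun t => Real.log (g t)) s) x
      = deriv (fun s => deriv g s) x / g x - (deriv g x / g x) ^ 2 := by
  have hev : (fun s => deriv (fun t => Real.log (g t)) s) =ᶠ[𝓝 x] fun s => deriv g s / g s := by
    filter_upwards [hg.eventually_differentiableAt_of_two,
      hg.continuousAt.eventually_ne hx] with s hs hs0
    exact deriv.log hs hs0
  rw [hev.deriv_eq, deriv_fun_div hg.differentiableAt_deriv_of_two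
    (hg.differentiableAt (by simp)) hx]
  field_simp

theorem deriv_id_mul {g : ℝ → ℝ} {x : ℝ} (hg : DifferentiableAt ℝ g x) :
    deriv (fun t => t * g t) x = g x + x * deriv g x := by
  rw [deriv_fun_mul differentiableAt_fun_id hg]
  simp

theorem deriv_deriv_id_mul {g : ℝ → ℝ} {x : ℝ} (hg : ContDiffAt ℝ 2 g x) :
    deriv (fun s => deriv (fun t => t * g t) s) x
      = 2 * deriv g x + x * deriv (fun s => deriv g s) x := by
  have hev : (fun s => deriv (fun t => t * g t) s) =ᶠ[𝓝 x] fun s => g s + s * deriv g s :=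
    hg.eventually_differentiableAt_of_two.mono fun _ hs => deriv_id_mul hs
  have hd : DifferentiableAt ℝ g x := hg.differentiableAt (by simp)
  have hd' := hg.differentiableAt_deriv_of_two
  rw [hev.deriv_eq, deriv_fun_add hd (differentiableAt_fun_id.fun_mul hd'), deriv_id_mul hd']
  ring


noncomputable section

/-- For a circle-invariant harmonic function `ρ` on Euclidean 4-space (i.e. a
JNR function, satisfying `z²Δρ + z∂_zρ = 0` on the upper half-space), the squared
Higgs-field norm of the associated hyperbolic monopole satisfies
`(z²/4ρ²)[(∂ₓρ)² + (∂_yρ)² + (ρ/z + ∂_zρ)²] = −(1/4)(1 + L log(zρ))`. -/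
theorem jnr_higgs_norm_identity (U : Set (ℝ × ℝ × ℝ)) (hU : IsOpen U)
    (hUz : ∀ q ∈ U, 0 < q.2.2)
    (ρ : ℝ → ℝ → ℝ → ℝ)
    (hρ : ContDiffOn ℝ (⊤ : ℕ∞) (fun q : ℝ × ℝ × ℝ => ρ q.1 q.2.1 q.2.2) U)
    (hρpos : ∀ q ∈ U, 0 < ρ q.1 q.2.1 q.2.2)
    (hharm : ∀ q ∈ U, ∀ x y z : ℝ, q = (x, y, z) →
      z ^ 2 * (pd1 (pd1 ρ) x y z + pd2 (pd2 ρ) x y z + pd3 (pd3 ρ) x y z)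
        + z * pd3 ρ x y z = 0) :
    ∀ q ∈ U, ∀ x y z : ℝ, q = (x, y, z) →
      (z ^ 2 / (4 * ρ x y z ^ 2))
          * ((pd1 ρ x y z) ^ 2 + (pd2 ρ x y z) ^ 2
            + (ρ x y z / z + pd3 ρ x y z) ^ 2)
        = -(1 / 4) * (1 + hypLap (fun a b c => Real.log (c * ρ a b c)) x y z) := by
  rintro q hq x y z rfl
  have hz : 0 < z := hUz _ hq
  have hr : 0 < ρ x y z := hρpos _ hq
  have hC : ContDiffAt ℝ 2 (fun q : ℝ × ℝ × ℝ => ρ q.1 q.2.1 q.2.2) (x, y, z) :=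
    (hρ.contDiffAt (hU.mem_nhds hq)).of_le (WithTop.coe_le_coe.2 (le_top : (2 : ℕ∞) ≤ ⊤))
  have h1 : ContDiffAt ℝ 2 (fun t => ρ t y z) x :=
    hC.comp (f := fun t : ℝ => (t, y, z)) x (by fun_prop)
  have h2 : ContDiffAt ℝ 2 (fun t => ρ x t z) y :=
    hC.comp (f := fun t : ℝ => (x, t, z)) y (by fun_prop)
  have h3 : ContDiffAt ℝ 2 (fun t => ρ x y t) z :=
    hC.comp (f := fun t : ℝ => (x, y, t)) z (by fun_prop)
  have hne : z * ρ x y z ≠ 0 := by positivity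
  have hh := hharm _ hq x y z rfl
  have e1 := deriv_deriv_log_comp (contDiffAt_const (c := z) |>.mul h1) hne
  have e2 := deriv_deriv_log_comp (contDiffAt_const (c := z) |>.mul h2) hne
  have e3 := deriv_deriv_log_comp (contDiffAt_id.mul h3) hne
  have e4 : deriv (fun t => Real.log (t * ρ x y t)) z = _ :=
    deriv.log (differentiableAt_fun_id.fun_mul (h3.differentiableAt (by simp))) hne
  simp only [deriv_const_mul_field] at e1 e2
  simp only [id] at e3
  rw [deriv_deriv_id_mul h3, deriv_id_mul (h3.differentiableAt (by simp))] at e3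
  rw [deriv_id_mul (h3.differentiableAt (by simp))] at e4
  simp only [hypLap, pd1, pd2, pd3] at hh ⊢
  rw [e1, e2, e3, e4]
  generalize deriv (fun s => deriv (fun t => ρ t y z) s) x = a at *
  generalize deriv (fun s => deriv (fun t => ρ x t z) s) y = b at *
  generalize deriv (fun s => deriv (fun t => ρ x y t) s) z = c at *
  field_simp
  linear_combination (ρ x y z) * hh
end
end

section
/- The function ρ(x,y,z) = [ (1 + x² + y² + z²)² − 4z² ]^{−1/2} is well defined and smooth on {(x,y,z) : z > 0} ∖ {(0,0,1)}, and satisfies z²(∂²_xρ + ∂²_yρ + ∂²_zρ) + z ∂_zρ = 0 there; that is, ρ is a circle-invariant harmonic function on Euclidean 4-space, singular only at the point (0,0,1). It is the JNR function of the singular Abelian hyperbolic monopole Λ = (2 sinh r)^{−1}, whose JNR pole lies in the interior of hyperbolic space rather than on its boundary. -/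
noncomputable section

theorem hasDerivAt_one_div_sqrt {g : ℝ → ℝ} {a t : ℝ} (hg : HasDerivAt g a t)
    (hpos : 0 < g t) :
    HasDerivAt (fun s => 1 / √(g s)) (-a / (2 * (g t * √(g t)))) t := by
  have hs : √(g t) ≠ 0 := (Real.sqrt_pos.2 hpos).ne'
  have h := (hg.sqrt hpos.ne').fun_inv hs
  simp only [one_div]
  refine h.congr_deriv ?_
  rw [Real.sq_sqrt hpos.le]
  field_simp

theorem deriv_deriv_one_div_sqrt {g g' : ℝ → ℝ} {b t : ℝ}
    (hg : ∀ s, HasDerivAt g (g' s) s) (hg' : HasDerivAt g' b t) (hpos : 0 < g t) :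
    deriv (deriv fun s => 1 / √(g s)) t =
      (3 * g' t ^ 2 - 2 * g t * b) / (4 * g t ^ 2 * √(g t)) := by
  have hev : (deriv fun s => 1 / √(g s)) =ᶠ[nhds t]
      fun s => -g' s / (2 * (g s * √(g s))) := by
    filter_upwards [(hg t).continuousAt.eventually (lt_mem_nhds hpos)] with s hs
    exact (hasDerivAt_one_div_sqrt (hg s) hs).deriv
  have hs : √(g t) ≠ 0 := (Real.sqrt_pos.2 hpos).ne'
  have hsq : √(g t) ^ 2 = g t := Real.sq_sqrt hpos.le
  have hden : 2 * (g t * √(g t)) ≠ 0 := by positivity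
  rw [hev.deriv_eq, (hg'.fun_neg.fun_div
    (((hg t).fun_mul ((hg t).sqrt hpos.ne')).const_mul 2) hden).deriv]
  have hne := hpos.ne'
  generalize √(g t) = w at *
  rw [← hsq] at hne ⊢
  field_simp
  ring

theorem jnr_radicand_pos {x y z : ℝ} (hz : 0 < z) (h : (x, y, z) ≠ ((0 : ℝ), (0 : ℝ), (1 : ℝ))) :
    0 < (1 + x ^ 2 + y ^ 2 + z ^ 2) ^ 2 - 4 * z ^ 2 := by
  have hfac : (1 + x ^ 2 + y ^ 2 + z ^ 2) ^ 2 - 4 * z ^ 2 =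
      (x ^ 2 + y ^ 2 + (z - 1) ^ 2) * (x ^ 2 + y ^ 2 + (z + 1) ^ 2) := by ring
  rw [hfac]
  refine mul_pos (lt_of_le_of_ne (by positivity) fun h0 => h ?_) (by positivity)
  have hx : x = 0 := by nlinarith [sq_nonneg x, sq_nonneg y, sq_nonneg (z - 1)]
  have hy : y = 0 := by nlinarith [sq_nonneg x, sq_nonneg y, sq_nonneg (z - 1)]
  have hz1 : z - 1 = 0 := by nlinarith [sq_nonneg x, sq_nonneg y, sq_nonneg (z - 1)]
  rw [hx, hy, sub_eq_zero.1 hz1]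

/-- The radicand of the JNR function along a line parallel to one of the first two axes. -/
theorem hasDerivAt_jnr_radicand_horizontal (c d t : ℝ) :
    HasDerivAt (fun s : ℝ => (s ^ 2 + c) ^ 2 - d) (4 * t * (t ^ 2 + c)) t := by
  refine ((((hasDerivAt_pow 2 t).add_const c).fun_pow 2).sub_const d).congr_deriv ?_
  norm_num
  ring

/-- The radicand of the JNR function along a line parallel to the third axis. -/
theorem hasDerivAt_jnr_radicand_vertical (c t : ℝ) :
    HasDerivAt (fun s : ℝ => (c + s ^ 2) ^ 2 - 4 * s ^ 2) (4 * t * (c + t ^ 2 - 2)) t := by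
  refine ((((hasDerivAt_pow 2 t).const_add c).fun_pow 2).fun_sub
    ((hasDerivAt_pow 2 t).const_mul 4)).congr_deriv ?_
  norm_num
  ring

theorem hasDerivAt_four_mul_mul_sq_add (c t : ℝ) :
    HasDerivAt (fun s : ℝ => 4 * s * (s ^ 2 + c)) (12 * t ^ 2 + 4 * c) t := by
  refine (((hasDerivAt_id' t).const_mul 4).fun_mul
    ((hasDerivAt_pow 2 t).add_const c)).congr_deriv ?_
  norm_num
  ring

/-- The JNR function `ρ = [(1 + x² + y² + z²)² − 4z²]^{−1/2}` of the singular Abelian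
hyperbolic monopole `Λ = (2 sinh r)⁻¹` is well defined and smooth on the upper
half-space minus the point `(0,0,1)`, and is a circle-invariant harmonic function on
Euclidean 4-space there: `z²(∂²ₓρ + ∂²_yρ + ∂²_zρ) + z ∂_zρ = 0`. -/
theorem jnr_function_singular_abelian_monopole :
    let ρ : ℝ → ℝ → ℝ → ℝ := fun x y z =>
      1 / Real.sqrt ((1 + x ^ 2 + y ^ 2 + z ^ 2) ^ 2 - 4 * z ^ 2)
    let S : Set (ℝ × ℝ × ℝ) := {q | 0 < q.2.2} \ {((0 : ℝ), (0 : ℝ), (1 : ℝ))}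
    (∀ q ∈ S, ∀ x y z : ℝ, q = (x, y, z) →
      0 < (1 + x ^ 2 + y ^ 2 + z ^ 2) ^ 2 - 4 * z ^ 2) ∧
    ContDiffOn ℝ (⊤ : ℕ∞) (fun q : ℝ × ℝ × ℝ => ρ q.1 q.2.1 q.2.2) S ∧
    (∀ q ∈ S, ∀ x y z : ℝ, q = (x, y, z) →
      z ^ 2 * (pd1 (pd1 ρ) x y z + pd2 (pd2 ρ) x y z + pd3 (pd3 ρ) x y z)
        + z * pd3 ρ x y z = 0) := by
  intro ρ S
  have hpos : ∀ q ∈ S, ∀ x y z : ℝ, q = (x, y, z) →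
      0 < (1 + x ^ 2 + y ^ 2 + z ^ 2) ^ 2 - 4 * z ^ 2 := by
    rintro _ ⟨hz, hne⟩ x y z rfl
    exact jnr_radicand_pos hz hne
  refine ⟨hpos, ?_, ?_⟩
  · have hrad : ∀ q ∈ S, 0 < (1 + q.1 ^ 2 + q.2.1 ^ 2 + q.2.2 ^ 2) ^ 2 - 4 * q.2.2 ^ 2 :=
      fun q hq => hpos q hq q.1 q.2.1 q.2.2 rfl
    refine contDiffOn_const.div (ContDiffOn.sqrt ?_ fun q hq => (hrad q hq).ne')
      fun q hq => (Real.sqrt_pos.2 (hrad q hq)).ne'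
    fun_prop
  · intro q hq x y z hxyz
    have hP := hpos q hq x y z hxyz
    have h1 : pd1 (pd1 ρ) x y z = _ := deriv_deriv_one_div_sqrt
      (g := fun s => (1 + s ^ 2 + y ^ 2 + z ^ 2) ^ 2 - 4 * z ^ 2)
      (fun s => (hasDerivAt_jnr_radicand_horizontal
          (1 + y ^ 2 + z ^ 2) (4 * z ^ 2) s).congr_of_eventuallyEq
        (.of_forall fun s => by ring))
      (hasDerivAt_four_mul_mul_sq_add _ x) hP
    have h2 : pd2 (pd2 ρ) x y z = _ := deriv_deriv_one_div_sqrt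
      (g := fun s => (1 + x ^ 2 + s ^ 2 + z ^ 2) ^ 2 - 4 * z ^ 2)
      (fun s => (hasDerivAt_jnr_radicand_horizontal
          (1 + x ^ 2 + z ^ 2) (4 * z ^ 2) s).congr_of_eventuallyEq
        (.of_forall fun s => by ring))
      (hasDerivAt_four_mul_mul_sq_add _ y) hP
    have hv := hasDerivAt_jnr_radicand_vertical (1 + x ^ 2 + y ^ 2)
    have h3 : pd3 (pd3 ρ) x y z = _ := deriv_deriv_one_div_sqrt hv
      (b := 12 * z ^ 2 + 4 * (x ^ 2 + y ^ 2 - 1))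
      ((hasDerivAt_four_mul_mul_sq_add (x ^ 2 + y ^ 2 - 1) z).congr_of_eventuallyEq
        (.of_forall fun s => by ring)) hP
    have h4 : pd3 ρ x y z = _ := (hasDerivAt_one_div_sqrt (hv z) hP).deriv
    rw [h1, h2, h3, h4]
    have hs := (Real.sqrt_pos.2 hP).ne'
    have hP' := hP.ne'
    generalize √((1 + x ^ 2 + y ^ 2 + z ^ 2) ^ 2 - 4 * z ^ 2) = w at *
    obtain ⟨P, hPdef⟩ : ∃ P, P = (1 + x ^ 2 + y ^ 2 + z ^ 2) ^ 2 - 4 * z ^ 2 := ⟨_, rfl⟩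
    rw [← hPdef] at hP' ⊢
    field_simp
    rw [hPdef]
    ring
end
end
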